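/- arXiv:2002.04653 — 2 statements merged into one kernel-verified Lean document; each statement's English description precedes it below -/
import Mathlib

section
/- Let H be a real symmetric positive definite n×n matrix, let Q be a real n×n matrix with Q + Qᵀ = 0, let λ ∈ ℝ, and let u : ℝ → ℝⁿ be differentiable with u′(t) = −λ·(H⁻¹Q)·u(t) for all t. Then the discrete energy t ↦ u(t)ᵀ·H·u(t) is constant in time. -/
open scoped Matrix

theorem HasDerivAt.dotProduct_mulVec {ι : Type*} [Fintype ι] (A : Matrix ι ι ℝ)
    {u v : ℝ → ι → ℝ} {u' v' : ι → ℝ} {t : ℝ}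
    (hu : HasDerivAt u u' t) (hv : HasDerivAt v v' t) :
    HasDerivAt (fun s => u s ⬝ᵥ A.mulVec (v s)) (u' ⬝ᵥ A.mulVec (v t) + u t ⬝ᵥ A.mulVec v') t := by
  simp only [dotProduct, Matrix.mulVec, ← Finset.sum_add_distrib]
  exact HasDerivAt.fun_sum fun i _ => (hasDerivAt_pi.1 hu i).mul
    (HasDerivAt.fun_sum fun j _ => (hasDerivAt_pi.1 hv j).const_mul (A i j))

theorem Matrix.dotProduct_mulVec_self_eq_zero_of_add_transpose_eq_zero {ι : Type*} [Fintype ι]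
    {Q : Matrix ι ι ℝ} (hQ : Q + Qᵀ = 0) (x : ι → ℝ) : x ⬝ᵥ Q.mulVec x = 0 := by
  have h : x ⬝ᵥ Qᵀ.mulVec x = x ⬝ᵥ Q.mulVec x := by
    rw [Matrix.mulVec_transpose, dotProduct_comm, Matrix.dotProduct_mulVec]
  have h₀ : x ⬝ᵥ (Q + Qᵀ).mulVec x = 0 := by rw [hQ, Matrix.zero_mulVec, dotProduct_zero]
  rw [Matrix.add_mulVec, dotProduct_add, h] at h₀
  linarith

/-- Energy conservation: with H symmetric positive definite and Q skew-symmetric,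
solutions of u' = -λ H⁻¹Q u have constant discrete energy uᵀHu. -/
theorem stmt_2 (n : ℕ) (H Q : Matrix (Fin n) (Fin n) ℝ)
    (hH : H.PosDef) (hQ : Q + Qᵀ = 0) (lam : ℝ)
    (u : ℝ → (Fin n → ℝ))
    (hu : ∀ t : ℝ, HasDerivAt u (-(lam • (H⁻¹ * Q).mulVec (u t))) t) :
    ∀ s t : ℝ, u s ⬝ᵥ H.mulVec (u s) = u t ⬝ᵥ H.mulVec (u t) := by
  have hsymm : Hᵀ = H := by simpa using hH.isHermitian.eq
  have hdet : IsUnit H.det := (Matrix.isUnit_iff_isUnit_det H).1 hH.isUnit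
  have hzero (t : ℝ) : u t ⬝ᵥ H.mulVec (-(lam • (H⁻¹ * Q).mulVec (u t))) = 0 := by
    rw [Matrix.mulVec_neg, Matrix.mulVec_smul, Matrix.mulVec_mulVec,
      Matrix.mul_nonsing_inv_cancel_left H Q hdet, dotProduct_neg, dotProduct_smul,
      Matrix.dotProduct_mulVec_self_eq_zero_of_add_transpose_eq_zero hQ, smul_zero, neg_zero]
  have henergy (t : ℝ) : HasDerivAt (fun s => u s ⬝ᵥ H.mulVec (u s)) 0 t := by
    refine ((hu t).dotProduct_mulVec H (hu t)).congr_deriv ?_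
    rw [hzero, add_zero, Matrix.dotProduct_mulVec, ← Matrix.mulVec_transpose, hsymm,
      dotProduct_comm, hzero]
  exact is_const_of_deriv_eq_zero (fun t => (henergy t).differentiableAt)
    fun t => (henergy t).deriv
end

section
/- Let K ≥ 1 and n_k ≥ 2 be natural numbers and set n = K·(n_k − 1). For κ = 0,…,K−1 let R_κ be the n_k×n real matrix with (R_κ)_{ij} = 1 if j ≡ κ·(n_k−1) + i (mod n) and 0 otherwise (indices i = 0,…,n_k−1 and j = 0,…,n−1), and let E be the n_k×n_k diagonal matrix with E_{00} = −1, E_{(n_k−1)(n_k−1)} = 1, and all other entries 0. Then Σ_{κ=0}^{K−1} R_κᵀ·E·R_κ = 0. -/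
open scoped Matrix

/-- Contracting against `diag(-1, 0, …, 0, 1)` leaves the difference of the values at the last
and the first index. -/
theorem sum_mul_boundary_mul {R : Type*} [CommRing R] (d : ℕ) (u v : Fin (d + 2) → R) :
    ∑ i, u i * (if (i : ℕ) = 0 then -1 else if (i : ℕ) = d + 1 then 1 else 0) * v i =
      u (Fin.last _) * v (Fin.last _) - u 0 * v 0 := by
  have h : ∀ i : Fin d, (i : ℕ) ≠ d := fun i => i.isLt.ne
  rw [Fin.sum_univ_succ, Fin.sum_univ_castSucc]
  simp [h]
  ring

/-- Periodic 1D assembly: the boundary matrices E = diag(−1,0,…,0,1) of the K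
elements cancel at the shared nodes, so Σ_κ RκᵀERκ = 0. -/
theorem stmt_14 (K nk : ℕ) (hK : 1 ≤ K) (hnk : 2 ≤ nk) :
    let n := K * (nk - 1)
    let R : Fin K → Matrix (Fin nk) (Fin n) ℝ := fun κ =>
      Matrix.of fun i j =>
        if ((κ : ℕ) * (nk - 1) + (i : ℕ)) % n = (j : ℕ) then 1 else 0
    let E : Matrix (Fin nk) (Fin nk) ℝ :=
      Matrix.of fun i j =>
        if i = j then
          (if (i : ℕ) = 0 then -1 else if (i : ℕ) = nk - 1 then 1 else 0)
        else 0
    ∑ κ, (R κ)ᵀ * E * R κ = 0 := by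
  intro n R E
  obtain ⟨d, rfl⟩ : ∃ d, nk = d + 2 := ⟨nk - 2, by omega⟩
  have hE : E = Matrix.diagonal fun i : Fin (d + 2) =>
      if (i : ℕ) = 0 then (-1 : ℝ) else if (i : ℕ) = d + 1 then 1 else 0 := by
    ext i j
    simp [E, Matrix.diagonal_apply]
  ext a b
  let f : ℕ → ℝ := fun m =>
    (if (m * (d + 1)) % n = (a : ℕ) then 1 else 0) * (if (m * (d + 1)) % n = (b : ℕ) then 1 else 0)
  have entry (κ : Fin K) : ((R κ)ᵀ * E * R κ) a b = f (κ + 1) - f κ := by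
    rw [hE, Matrix.mul_apply]
    simp only [Matrix.mul_diagonal, Matrix.transpose_apply]
    rw [sum_mul_boundary_mul d (fun i => R κ i a) (fun i => R κ i b)]
    simp [R, f, add_mul]
  have periodic : f K = f 0 := by
    have hn : K * (d + 1) % n = 0 := Nat.mod_self n
    simp only [f, hn, zero_mul, Nat.zero_mod]
  rw [Matrix.sum_apply, Finset.sum_congr rfl fun κ _ => entry κ,
    Fin.sum_univ_eq_sum_range (fun m => f (m + 1) - f m) K, Finset.sum_range_sub, periodic,
    sub_self, Matrix.zero_apply]
end
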